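/- Let m ≥ 1 be an integer, let p ∈ ℝ, and for 1 ≤ i ≤ m let u_i : ℝ^m ∖ {0} → ℝ be given by u_i(x) = x_i·|x|^{−p} (the components of the map φ(x) = x/|x|^p). Then Δ(Δu_i) = 0 identically on ℝ^m ∖ {0} for every i (i.e. the map φ is biharmonic) if and only if p(p − m)(p + 2)(p + 2 − m) = 0, that is, if and only if p = 0, p = m, p = −2, or p = m − 2. -/

import Mathlib

/-- The Euclidean Laplacian `Δu = ∑ i ∂²u/∂x_i²` of a function on `ℝ^m`. -/
noncomputable def eLaplacian {m : ℕ} (u : EuclideanSpace ℝ (Fin m) → ℝ)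
    (x : EuclideanSpace ℝ (Fin m)) : ℝ :=
  ∑ i : Fin m,
    fderiv ℝ (fun y => fderiv ℝ u y (EuclideanSpace.single i 1)) x (EuclideanSpace.single i 1)

theorem hasFDerivAt_norm_rpow_of_ne_zero {E : Type*} [NormedAddCommGroup E]
    [InnerProductSpace ℝ E] {y : E} (hy : y ≠ 0) (s : ℝ) :
    HasFDerivAt (fun y : E => ‖y‖ ^ s) ((s * ‖y‖ ^ (s - 2)) • innerSL ℝ y) y := by
  have hpow : ∀ (z : E) (r : ℝ), (‖z‖ ^ 2) ^ (r / 2) = ‖z‖ ^ r := fun z r => by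
    rw [← Real.rpow_natCast, ← Real.rpow_mul (norm_nonneg z)]
    congr 1
    push_cast
    ring
  have h := (hasStrictFDerivAt_norm_sq y).hasFDerivAt.rpow_const (p := s / 2)
    (Or.inl (pow_ne_zero 2 (norm_ne_zero_iff.mpr hy)))
  simp only [hpow] at h
  convert h using 1
  rw [show s / 2 - 1 = (s - 2) / 2 by ring, hpow, ← Nat.cast_smul_eq_nsmul ℝ, smul_smul]
  congr 1
  push_cast
  ring

theorem eLaplacian_congr {m : ℕ} {u v : EuclideanSpace ℝ (Fin m) → ℝ}
    {x : EuclideanSpace ℝ (Fin m)} (h : u =ᶠ[nhds x] v) : eLaplacian u x = eLaplacian v x := by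
  unfold eLaplacian
  refine Finset.sum_congr rfl fun i _ => ?_
  rw [Filter.EventuallyEq.fderiv_eq]
  filter_upwards [h.fderiv (𝕜 := ℝ)] with y hy
  rw [hy]

theorem hasFDerivAt_euclideanSpace_apply {m : ℕ} (i : Fin m) (y : EuclideanSpace ℝ (Fin m)) :
    HasFDerivAt (fun y : EuclideanSpace ℝ (Fin m) => y i)
      (EuclideanSpace.proj i : EuclideanSpace ℝ (Fin m) →L[ℝ] ℝ) y :=
  (EuclideanSpace.proj i : EuclideanSpace ℝ (Fin m) →L[ℝ] ℝ).hasFDerivAt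

theorem fderiv_const_mul_coord_mul_norm_rpow {m : ℕ} (c s : ℝ) (i j : Fin m)
    {y : EuclideanSpace ℝ (Fin m)} (hy : y ≠ 0) :
    fderiv ℝ (fun y : EuclideanSpace ℝ (Fin m) => c * (y i * ‖y‖ ^ s)) y
        (EuclideanSpace.single j 1) =
      c * ((if i = j then 1 else 0) * ‖y‖ ^ s + s * (y i * (y j * ‖y‖ ^ (s - 2)))) := by
  rw [(((hasFDerivAt_euclideanSpace_apply i y).fun_mul
    (hasFDerivAt_norm_rpow_of_ne_zero hy s)).const_mul c).fderiv]
  by_cases hij : i = j <;>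
    simp [EuclideanSpace.inner_single_right, hij, -mul_eq_mul_left_iff] <;>
    ring

theorem eLaplacian_const_mul_coord_mul_norm_rpow {m : ℕ} (c s : ℝ) (i : Fin m)
    {x : EuclideanSpace ℝ (Fin m)} (hx : x ≠ 0) :
    eLaplacian (fun y : EuclideanSpace ℝ (Fin m) => c * (y i * ‖y‖ ^ s)) x =
      c * (s * (s + m)) * (x i * ‖x‖ ^ (s - 2)) := by
  have key : ∀ j : Fin m,
      fderiv ℝ (fun z => fderiv ℝ (fun y : EuclideanSpace ℝ (Fin m) => c * (y i * ‖y‖ ^ s)) z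
        (EuclideanSpace.single j 1)) x (EuclideanSpace.single j 1) =
      c * s * ((if i = j then 2 * x j * ‖x‖ ^ (s - 2) else 0) + x i * ‖x‖ ^ (s - 2)
        + (s - 2) * x i * ‖x‖ ^ (s - 4) * x j ^ 2) := by
    intro j
    have hev : (fun z => fderiv ℝ (fun y : EuclideanSpace ℝ (Fin m) => c * (y i * ‖y‖ ^ s)) z
        (EuclideanSpace.single j 1)) =ᶠ[nhds x] fun y : EuclideanSpace ℝ (Fin m) =>
        c * ((if i = j then 1 else 0) * ‖y‖ ^ s + s * (y i * (y j * ‖y‖ ^ (s - 2)))) := by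
      filter_upwards [isOpen_ne.mem_nhds hx] with y hy
      exact fderiv_const_mul_coord_mul_norm_rpow c s i j hy
    rw [hev.fderiv_eq, ((((hasFDerivAt_norm_rpow_of_ne_zero hx s).const_mul _).fun_add
      (((hasFDerivAt_euclideanSpace_apply i x).fun_mul
        ((hasFDerivAt_euclideanSpace_apply j x).fun_mul
          (hasFDerivAt_norm_rpow_of_ne_zero hx (s - 2)))).const_mul s)).const_mul c).fderiv]
    rw [show s - 2 - 2 = s - 4 by ring]
    by_cases hij : i = j
    · subst hij
      simp [EuclideanSpace.inner_single_right]
      ring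
    · simp [EuclideanSpace.inner_single_right, hij]
      ring
  have hsum : ∑ j, x j ^ 2 = ‖x‖ ^ 2 := (EuclideanSpace.real_norm_sq_eq x).symm
  have hpow : ‖x‖ ^ (s - 2) = ‖x‖ ^ (s - 4) * ‖x‖ ^ 2 := by
    rw [← Real.rpow_natCast, ← Real.rpow_add (norm_pos_iff.mpr hx)]
    congr 1
    push_cast
    ring
  unfold eLaplacian
  simp only [key]
  rw [← Finset.mul_sum, Finset.sum_add_distrib, Finset.sum_add_distrib,
    ← Finset.mul_sum (f := fun j => x j ^ 2), hsum, Finset.sum_ite_eq]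
  simp only [Finset.mem_univ, if_true, Finset.sum_const, Finset.card_univ, Fintype.card_fin,
    nsmul_eq_mul]
  rw [hpow]
  ring

theorem eLaplacian_eLaplacian_coord_mul_norm_rpow {m : ℕ} (p : ℝ) (i : Fin m)
    {x : EuclideanSpace ℝ (Fin m)} (hx : x ≠ 0) :
    eLaplacian (eLaplacian fun y : EuclideanSpace ℝ (Fin m) => y i * ‖y‖ ^ (-p)) x =
      p * (p - m) * (p + 2) * (p + 2 - m) * (x i * ‖x‖ ^ (-p - 4)) := by
  have hev : (eLaplacian fun y : EuclideanSpace ℝ (Fin m) => y i * ‖y‖ ^ (-p)) =ᶠ[nhds x]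
      fun y => (-p * (-p + m)) * (y i * ‖y‖ ^ (-p - 2)) := by
    filter_upwards [isOpen_ne.mem_nhds hx] with y hy
    simpa using eLaplacian_const_mul_coord_mul_norm_rpow 1 (-p) i hy
  rw [eLaplacian_congr hev, eLaplacian_const_mul_coord_mul_norm_rpow _ _ i hx,
    show -p - 2 - 2 = -p - 4 by ring]
  ring

/-- The map `φ(x) = x/|x|^p`, with components `u_i(x) = x_i·|x|^{−p}`, is biharmonic on
`ℝ^m ∖ {0}` (i.e. `Δ(Δu_i) = 0` for every `i`) if and only if
`p(p − m)(p + 2)(p + 2 − m) = 0`, i.e. iff `p = 0`, `p = m`, `p = −2`, or `p = m − 2`. -/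
theorem stmt_10 (m : ℕ) (hm : 1 ≤ m) (p : ℝ)
    (u : Fin m → EuclideanSpace ℝ (Fin m) → ℝ)
    (hu : ∀ i : Fin m, u i = fun x => x i * ‖x‖ ^ (-p)) :
    ((∀ i : Fin m, ∀ x : EuclideanSpace ℝ (Fin m), x ≠ 0 →
        eLaplacian (eLaplacian (u i)) x = 0)
      ↔ p * (p - (m : ℝ)) * (p + 2) * (p + 2 - (m : ℝ)) = 0) ∧
    (p * (p - (m : ℝ)) * (p + 2) * (p + 2 - (m : ℝ)) = 0
      ↔ (p = 0 ∨ p = (m : ℝ) ∨ p = -2 ∨ p = (m : ℝ) - 2)) := by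
  refine ⟨⟨fun h => ?_, fun h i x hx => ?_⟩, ?_⟩
  · let i : Fin m := ⟨0, hm⟩
    have hx : (EuclideanSpace.single i 1 : EuclideanSpace ℝ (Fin m)) ≠ 0 := by simp
    have := h i _ hx
    rw [hu, eLaplacian_eLaplacian_coord_mul_norm_rpow p i hx] at this
    simpa only [PiLp.single_apply, if_true, PiLp.norm_single, norm_one, Real.one_rpow,
      mul_one] using this
  · rw [hu, eLaplacian_eLaplacian_coord_mul_norm_rpow p i hx, h, zero_mul]
  · simp only [mul_eq_zero, or_assoc, sub_eq_zero, add_eq_zero_iff_eq_neg, eq_sub_iff_add_eq]
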